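/- arXiv:1309.7746 — 6 statements merged into one kernel-verified Lean document; each statement's English description precedes it below -/
import Mathlib

section
/- Let A be a complex vector space with a ℂ-trilinear 3-bracket [·,·,·] satisfying anti-commutativity [a,b,c] = −[c,b,a] and the fundamental identity [a,b,[x,y,z]] = [[a,b,x],y,z] − [x,[b,a,y],z] + [x,y,[a,b,z]] (an algebraic N=6 3-algebra). Let C : A → A be an additive map with C(λa) = λ̄·C(a) for all λ ∈ ℂ, C∘C = id, and C([a,b,c]) = [C(a),C(b),C(c)] for all a,b,c (an anti-linear involution of the 3-algebra). Then the new 3-bracket ⟨a,b,c⟩ := [a, C(b), c] is ℂ-linear in the first and third arguments, conjugate-linear in the second, and satisfies anti-commutativity ⟨a,b,c⟩ = −⟨c,b,a⟩ and the fundamental identity ⟨a,b,⟨x,y,z⟩⟩ = ⟨⟨a,b,x⟩,y,z⟩ − ⟨x,⟨b,a,y⟩,z⟩ + ⟨x,y,⟨a,b,z⟩⟩. -/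
/-- From an algebraic `N=6` 3-algebra with an anti-linear involution `C`, the bracket
`⟨a,b,c⟩ = [a, C b, c]` defines a physical `N=6` 3-algebra. -/
theorem stmt_1 {A : Type*} [AddCommGroup A] [Module ℂ A]
    (br : A → A → A → A)
    (add1 : ∀ a a' b c, br (a + a') b c = br a b c + br a' b c)
    (add2 : ∀ a b b' c, br a (b + b') c = br a b c + br a b' c)
    (add3 : ∀ a b c c', br a b (c + c') = br a b c + br a b c')
    (sm1 : ∀ (l : ℂ) (a b c : A), br (l • a) b c = l • br a b c)
    (sm2 : ∀ (l : ℂ) (a b c : A), br a (l • b) c = l • br a b c)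
    (sm3 : ∀ (l : ℂ) (a b c : A), br a b (l • c) = l • br a b c)
    (anti : ∀ a b c, br a b c = - br c b a)
    (fund : ∀ a b x y z,
      br a b (br x y z) = br (br a b x) y z - br x (br b a y) z + br x y (br a b z))
    (C : A → A)
    (Cadd : ∀ a b, C (a + b) = C a + C b)
    (Csmul : ∀ (l : ℂ) (a : A), C (l • a) = (starRingEnd ℂ) l • C a)
    (Cinv : ∀ a, C (C a) = a)
    (Cbr : ∀ a b c, C (br a b c) = br (C a) (C b) (C c)) :
    ∀ nbr : A → A → A → A, (∀ a b c, nbr a b c = br a (C b) c) →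
      ((∀ (l : ℂ) (a a' b c : A), nbr (l • a + a') b c = l • nbr a b c + nbr a' b c) ∧
       (∀ (l : ℂ) (a b b' c : A),
         nbr a (l • b + b') c = (starRingEnd ℂ) l • nbr a b c + nbr a b' c) ∧
       (∀ (l : ℂ) (a b c c' : A), nbr a b (l • c + c') = l • nbr a b c + nbr a b c') ∧
       (∀ a b c : A, nbr a b c = - nbr c b a) ∧
       (∀ a b x y z : A,
         nbr a b (nbr x y z) =
           nbr (nbr a b x) y z - nbr x (nbr b a y) z + nbr x y (nbr a b z))) := by
  intro nbr h
  refine ⟨?_, ?_, ?_, ?_, ?_⟩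
  · intro l a a' b c
    rw [h, h, h, add1, sm1]
  · intro l a b b' c
    rw [h, h, h, Cadd, Csmul, add2, sm2]
  · intro l a b c c'
    rw [h, h, h, add3, sm3]
  · intro a b c
    rw [h, h, anti]
  · intro a b x y z
    simp only [h, Cbr, Cinv]
    exact fund a (C b) x (C y) z
end

section
/- Let A ∈ GL_n(ℂ), B ∈ GL_m(ℂ) and λ ∈ ℂ, λ ≠ 0, be such that A = λ Āᵗ and B = λ B̄ᵗ (bar denotes entrywise complex conjugation, t the transpose). Then the map φ_{A,B} : M_{m,n}(ℂ) → M_{n,m}(ℂ) defined by φ_{A,B}(u) = A ūᵗ B⁻¹ satisfies φ_{A,B}(a·φ_{A,B}(b)·c) = φ_{A,B}(c)·b·φ_{A,B}(a) for all a,b,c ∈ M_{m,n}(ℂ); consequently the 3-bracket [a,b,c] = a·φ_{A,B}(b)·c − c·φ_{A,B}(b)·a satisfies anti-commutativity [a,b,c] = −[c,b,a] and the fundamental identity [a,b,[x,y,z]] = [[a,b,x],y,z] − [x,[b,a,y],z] + [x,y,[a,b,z]]. -/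
open Matrix

/-- For invertible `A, B` with `A = λ Āᵗ`, `B = λ B̄ᵗ` (`λ ≠ 0`), the map
`φ(u) = A ūᵗ B⁻¹` satisfies `φ(a φ(b) c) = φ(c) b φ(a)`, and the corresponding
3-bracket satisfies anti-commutativity and the fundamental identity. -/
theorem stmt_3 (m n : ℕ) (A : Matrix (Fin n) (Fin n) ℂ) (B : Matrix (Fin m) (Fin m) ℂ)
    (hA : IsUnit A.det) (hB : IsUnit B.det) (l : ℂ) (hl : l ≠ 0)
    (hAl : A = l • Aᴴ) (hBl : B = l • Bᴴ) :
    ∀ φ : Matrix (Fin m) (Fin n) ℂ → Matrix (Fin n) (Fin m) ℂ,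
      (∀ u, φ u = A * uᴴ * B⁻¹) →
      ((∀ a b c : Matrix (Fin m) (Fin n) ℂ, φ (a * φ b * c) = φ c * b * φ a) ∧
       (∀ br : Matrix (Fin m) (Fin n) ℂ → Matrix (Fin m) (Fin n) ℂ →
            Matrix (Fin m) (Fin n) ℂ → Matrix (Fin m) (Fin n) ℂ,
          (∀ a b c, br a b c = a * φ b * c - c * φ b * a) →
          ((∀ a b c : Matrix (Fin m) (Fin n) ℂ, br a b c = - br c b a) ∧
           (∀ a b x y z : Matrix (Fin m) (Fin n) ℂ,
              br a b (br x y z) =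
                br (br a b x) y z - br x (br b a y) z + br x y (br a b z))))) := by
  intro φ hφ
  have hdual : ∀ b : Matrix (Fin m) (Fin n) ℂ, (A * bᴴ * B⁻¹)ᴴ = B⁻¹ * b * A := by
    intro b
    have hBinv : B⁻¹ = l⁻¹ • (B⁻¹)ᴴ := by
      apply Matrix.inv_eq_right_inv
      rw [hBl, smul_mul_smul_comm, mul_inv_cancel₀ hl, one_smul, ← hBl,
        ← conjTranspose_mul, nonsing_inv_mul B hB, conjTranspose_one]
    calc (A * bᴴ * B⁻¹)ᴴ = (B⁻¹)ᴴ * b * Aᴴ := by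
          simp only [conjTranspose_mul, conjTranspose_conjTranspose, Matrix.mul_assoc]
      _ = (l⁻¹ • (B⁻¹)ᴴ) * b * (l • Aᴴ) := by
          simp only [Matrix.smul_mul, Matrix.mul_smul, smul_smul, mul_inv_cancel₀ hl, one_smul]
      _ = B⁻¹ * b * A := by rw [← hBinv, ← hAl]
  have htriple : ∀ a b c : Matrix (Fin m) (Fin n) ℂ, φ (a * φ b * c) = φ c * b * φ a := by
    intro a b c
    rw [hφ (a * φ b * c), conjTranspose_mul, conjTranspose_mul, hφ b, hdual, hφ a, hφ c]
    simp only [Matrix.mul_assoc]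
  have hsub : ∀ u v : Matrix (Fin m) (Fin n) ℂ, φ (u - v) = φ u - φ v := by
    intro u v
    simp only [hφ, conjTranspose_sub, Matrix.mul_sub, Matrix.sub_mul]
  refine ⟨htriple, fun br hbr => ⟨fun a b c => ?_, fun a b x y z => ?_⟩⟩
  · rw [hbr, hbr, neg_sub]
  · simp only [hbr, hsub, htriple]
    simp only [Matrix.mul_sub, Matrix.sub_mul, Matrix.mul_assoc]
    abel
end

section
/- Let h,k be positive integers. There exists a ℂ-linear bijection f : M_{2h,2k}(ℂ) → M_{2h,2k}(ℂ) such that for all a,b,c ∈ M_{2h,2k}(ℂ): f(a S^{2k}_k b̄ᵗ S^{2h}_h c − c S^{2k}_k b̄ᵗ S^{2h}_h a) = f(a) J_{2k} \overline{f(b)}ᵗ J_{2h}⁻¹ f(c) − f(c) J_{2k} \overline{f(b)}ᵗ J_{2h}⁻¹ f(a). In other words, the physical N=6 3-algebra A³(2h,2k;st)_{ph,C₀} with bracket [a,b,c] = a(J_{2k} b̄ᵗ J_{2h}⁻¹)c − c(J_{2k} b̄ᵗ J_{2h}⁻¹)a is isomorphic to A³(2h,2k;t)_{ph,C_{k,h}}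 with bracket [a,b,c] = a S^{2k}_k b̄ᵗ S^{2h}_h c − c S^{2k}_k b̄ᵗ S^{2h}_h a. -/
open Matrix

/-- `S^n_p = diag(I_p, −I_{n−p})`. -/
noncomputable def Smat (n p : ℕ) : Matrix (Fin n) (Fin n) ℂ :=
  Matrix.diagonal fun i => if (i : ℕ) < p then 1 else -1

/-- `J_{2k} = [[0, I_k], [−I_k, 0]]`. -/
noncomputable def Jmat (k : ℕ) : Matrix (Fin (2 * k)) (Fin (2 * k)) ℂ :=
  Matrix.of fun i j =>
    if (i : ℕ) + k = (j : ℕ) then 1 else if (j : ℕ) + k = (i : ℕ) then -1 else 0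

/-- The splitting of `Fin (2 * k)` into two halves of size `k`. -/
def halvesEquiv (k : ℕ) : Fin k ⊕ Fin k ≃ Fin (2 * k) :=
  finSumFinEquiv.trans (finCongr (two_mul k).symm)

/-- The algebra isomorphism presenting `2k × 2k` matrices as `2 × 2` block matrices. -/
noncomputable def ofBlocks (k : ℕ) :
    Matrix (Fin k ⊕ Fin k) (Fin k ⊕ Fin k) ℂ ≃ₐ[ℂ] Matrix (Fin (2 * k)) (Fin (2 * k)) ℂ :=
  reindexAlgEquiv ℂ ℂ (halvesEquiv k)

/-- The matrix `[[I_k, -i I_k], [I_k, i I_k]]`, whose rows are left eigenvectors of `J_{2k}`. -/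
noncomputable def eigenMat (k : ℕ) : Matrix (Fin (2 * k)) (Fin (2 * k)) ℂ :=
  ofBlocks k (fromBlocks 1 (-Complex.I • 1) 1 (Complex.I • 1))

lemma Smat_eq_ofBlocks (k : ℕ) :
    Smat (2 * k) k = ofBlocks k (fromBlocks 1 0 0 (-1)) := by
  apply (reindex (halvesEquiv k) (halvesEquiv k)).symm_apply_eq.mp
  ext (i | i) (j | j) <;>
    simp [halvesEquiv, Smat, diagonal_apply, one_apply, Fin.ext_iff] <;> grind

lemma Jmat_eq_ofBlocks (k : ℕ) :
    Jmat k = ofBlocks k (fromBlocks 0 1 (-1) 0) := by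
  apply (reindex (halvesEquiv k) (halvesEquiv k)).symm_apply_eq.mp
  ext (i | i) (j | j) <;>
    simp [halvesEquiv, Jmat, one_apply, Fin.ext_iff] <;> grind

lemma Jmat_inv (k : ℕ) : (Jmat k)⁻¹ = -Jmat k := by
  apply inv_eq_right_inv
  rw [Jmat_eq_ofBlocks, ← map_neg, ← map_mul, ← map_one (ofBlocks k)]
  simp [fromBlocks_multiply, fromBlocks_neg]

lemma conjTranspose_eigenMat (k : ℕ) :
    (eigenMat k)ᴴ = ofBlocks k (fromBlocks 1 1 (Complex.I • 1) (-Complex.I • 1)) := by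
  simp [eigenMat, ofBlocks, conjTranspose_submatrix, fromBlocks_conjTranspose]

lemma eigenMat_mul_conjTranspose (k : ℕ) :
    eigenMat k * (eigenMat k)ᴴ = (2 : ℂ) • 1 := by
  rw [conjTranspose_eigenMat, eigenMat, ← map_mul, ← map_one (ofBlocks k), ← map_smul,
    ← fromBlocks_one]
  congr 1
  simp [fromBlocks_multiply, fromBlocks_add, smul_smul, two_smul, -fromBlocks_one]

lemma conjTranspose_mul_eigenMat (k : ℕ) :
    (eigenMat k)ᴴ * eigenMat k = (2 : ℂ) • 1 := by
  rw [conjTranspose_eigenMat, eigenMat, ← map_mul, ← map_one (ofBlocks k), ← map_smul,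
    ← fromBlocks_one]
  congr 1
  simp [fromBlocks_multiply, fromBlocks_add, smul_smul, two_smul, -fromBlocks_one]

lemma eigenMat_mul_Jmat_mul_conjTranspose (k : ℕ) :
    eigenMat k * (Jmat k * (eigenMat k)ᴴ) = (2 * Complex.I) • Smat (2 * k) k := by
  rw [conjTranspose_eigenMat, eigenMat, Smat_eq_ofBlocks, Jmat_eq_ofBlocks, ← map_mul,
    ← map_mul, ← map_smul]
  congr 1
  simp [fromBlocks_multiply, fromBlocks_smul, fromBlocks_add, two_mul, add_smul]

/-- The linear bijection `a ↦ (1/2) W_hᴴ a W_k`, where `W_n` is `eigenMat n`. -/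
noncomputable def eigenConj (h k : ℕ) :
    Matrix (Fin (2 * h)) (Fin (2 * k)) ℂ ≃ₗ[ℂ] Matrix (Fin (2 * h)) (Fin (2 * k)) ℂ where
  toFun a := (2⁻¹ : ℂ) • ((eigenMat h)ᴴ * (a * eigenMat k))
  invFun a := (2⁻¹ : ℂ) • (eigenMat h * (a * (eigenMat k)ᴴ))
  map_add' a b := by simp [Matrix.add_mul, Matrix.mul_add]
  map_smul' c a := by simp [smul_comm c]
  left_inv a := by
    simp [Matrix.mul_assoc, eigenMat_mul_conjTranspose, smul_smul,
      ← Matrix.mul_assoc (eigenMat h)]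
  right_inv a := by
    simp [Matrix.mul_assoc, conjTranspose_mul_eigenMat, smul_smul,
      ← Matrix.mul_assoc (eigenMat h)ᴴ]

lemma eigenConj_apply (h k : ℕ) (a : Matrix (Fin (2 * h)) (Fin (2 * k)) ℂ) :
    eigenConj h k a = (2⁻¹ : ℂ) • ((eigenMat h)ᴴ * (a * eigenMat k)) := rfl

lemma eigenConj_triple_product (h k : ℕ) (a b c : Matrix (Fin (2 * h)) (Fin (2 * k)) ℂ) :
    eigenConj h k (a * Smat (2 * k) k * bᴴ * Smat (2 * h) h * c) =
      eigenConj h k a * (Jmat k * (eigenConj h k b)ᴴ * (Jmat h)⁻¹) * eigenConj h k c := by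
  have regroup : eigenConj h k a * (Jmat k * (eigenConj h k b)ᴴ * (Jmat h)⁻¹) * eigenConj h k c =
      (-8⁻¹ : ℂ) • ((eigenMat h)ᴴ * (a * (eigenMat k * (Jmat k * (eigenMat k)ᴴ)) * bᴴ *
        (eigenMat h * (Jmat h * (eigenMat h)ᴴ)) * c * eigenMat k)) := by
    simp only [eigenConj_apply, Jmat_inv, conjTranspose_smul, conjTranspose_mul,
      conjTranspose_conjTranspose, Matrix.mul_assoc, Matrix.smul_mul, Matrix.mul_smul,
      Matrix.mul_neg, smul_smul, ← neg_smul]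
    congr 1
    norm_num
  rw [regroup, eigenMat_mul_Jmat_mul_conjTranspose, eigenMat_mul_Jmat_mul_conjTranspose,
    eigenConj_apply]
  simp only [Matrix.smul_mul, Matrix.mul_smul, smul_smul, Matrix.mul_assoc]
  congr 1
  linear_combination (2⁻¹ : ℂ) * Complex.I_mul_I

/-- `A³(2h,2k;st)_{ph,C₀}` is isomorphic to `A³(2h,2k;t)_{ph,C_{k,h}}`. -/
theorem stmt_5 (h k : ℕ) (hh : 0 < h) (hk : 0 < k) :
    ∃ f : Matrix (Fin (2 * h)) (Fin (2 * k)) ℂ ≃ₗ[ℂ] Matrix (Fin (2 * h)) (Fin (2 * k)) ℂ,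
      ∀ a b c : Matrix (Fin (2 * h)) (Fin (2 * k)) ℂ,
        f (a * Smat (2 * k) k * bᴴ * Smat (2 * h) h * c
            - c * Smat (2 * k) k * bᴴ * Smat (2 * h) h * a) =
          f a * (Jmat k * (f b)ᴴ * (Jmat h)⁻¹) * f c
            - f c * (Jmat k * (f b)ᴴ * (Jmat h)⁻¹) * f a := by
  refine ⟨eigenConj h k, fun a b c => ?_⟩
  rw [map_sub, eigenConj_triple_product, eigenConj_triple_product]
end

section
/- Let 𝒜 be an associative ℂ-algebra and let † : 𝒜 → 𝒜 be an additive, conjugate-linear map ((λa)† = λ̄·a†) such that (a b† c)† = a† b c† for all a,b,c ∈ 𝒜. Then the 3-bracket [a,b,c] = i(a b† c − c b† a) (i the imaginary unit) is ℂ-linear in the first and third arguments, conjugate-linear in the second, and satisfies anti-commutativity [a,b,c] = −[c,b,a] and the fundamental identity [a,b,[x,y,z]] = [[a,b,x],y,z] − [x,[b,a,y],z] + [x,y,[a,b,z]]. -/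
/-- For an associative ℂ-algebra with a conjugate-linear map `†` satisfying
`(a b† c)† = a† b c†`, the bracket `[a,b,c] = i(a b† c − c b† a)` defines a
physical `N=6` 3-algebra. -/
theorem stmt_6 {𝒜 : Type*} [Ring 𝒜] [Algebra ℂ 𝒜]
    (dag : 𝒜 → 𝒜)
    (dadd : ∀ a b, dag (a + b) = dag a + dag b)
    (dsmul : ∀ (l : ℂ) (a : 𝒜), dag (l • a) = (starRingEnd ℂ) l • dag a)
    (dprop : ∀ a b c : 𝒜, dag (a * dag b * c) = dag a * b * dag c) :
    ∀ br : 𝒜 → 𝒜 → 𝒜 → 𝒜,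
      (∀ a b c, br a b c = Complex.I • (a * dag b * c - c * dag b * a)) →
      ((∀ (l : ℂ) (a a' b c : 𝒜), br (l • a + a') b c = l • br a b c + br a' b c) ∧
       (∀ (l : ℂ) (a b b' c : 𝒜),
          br a (l • b + b') c = (starRingEnd ℂ) l • br a b c + br a b' c) ∧
       (∀ (l : ℂ) (a b c c' : 𝒜), br a b (l • c + c') = l • br a b c + br a b c') ∧
       (∀ a b c : 𝒜, br a b c = - br c b a) ∧
       (∀ a b x y z : 𝒜,
          br a b (br x y z) =
            br (br a b x) y z - br x (br b a y) z + br x y (br a b z))) := by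
  intro br hbr
  have dsub (a b : 𝒜) : dag (a - b) = dag a - dag b := by
    have h := dadd (a - b) b
    rw [sub_add_cancel] at h
    exact eq_sub_of_add_eq h.symm
  refine ⟨?_, ?_, ?_, ?_, ?_⟩
  · intro l a a' b c
    simp only [hbr, add_mul, mul_add, smul_mul_assoc, mul_smul_comm]
    module
  · intro l a b b' c
    simp only [hbr, dadd, dsmul, add_mul, mul_add, smul_mul_assoc, mul_smul_comm]
    module
  · intro l a b c c'
    simp only [hbr, add_mul, mul_add, smul_mul_assoc, mul_smul_comm]
    module
  · intro a b c
    simp only [hbr]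
    module
  · intro a b x y z
    simp only [hbr, dsmul, dsub, dprop, Complex.conj_I]
    simp only [sub_mul, mul_sub, smul_mul_assoc, mul_smul_comm, smul_sub, smul_smul, neg_smul,
      smul_neg, mul_neg, neg_mul, Complex.I_mul_I, one_smul, neg_neg, mul_assoc]
    abel
end

section
/- Let n be a positive integer and A ∈ M_{n,n}(ℂ). The map ψ_A : M_{n,n}(ℂ) → M_{n,n}(ℂ) defined by ψ_A(u) = A ū Ā (ū the entrywise conjugate) satisfies ψ_A(a·ψ_A(b)·c) = ψ_A(a)·b·ψ_A(c) for all a,b,c ∈ M_{n,n}(ℂ); consequently the 3-bracket [a,b,c] = i(a A b̄ Ā c − c A b̄ Ā a) on M_{n,n}(ℂ) satisfies anti-commutativity [a,b,c] = −[c,b,a] and the fundamental identity [a,b,[x,y,z]] = [[a,b,x],y,z] − [x,[b,a,y],z] + [x,y,[a,b,z]]. -/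
open Matrix

/-- Entrywise complex conjugate of a complex matrix. -/
noncomputable def mconj {m n : ℕ} (u : Matrix (Fin m) (Fin n) ℂ) : Matrix (Fin m) (Fin n) ℂ :=
  u.map (starRingEnd ℂ)

theorem mconj_mul {l m n : ℕ} (u : Matrix (Fin l) (Fin m) ℂ) (v : Matrix (Fin m) (Fin n) ℂ) :
    mconj (u * v) = mconj u * mconj v :=
  Matrix.map_mul

theorem mconj_mconj {m n : ℕ} (u : Matrix (Fin m) (Fin n) ℂ) : mconj (mconj u) = u := by
  ext
  simp [mconj]

theorem mconj_sub {m n : ℕ} (u v : Matrix (Fin m) (Fin n) ℂ) :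
    mconj (u - v) = mconj u - mconj v := by
  ext
  simp [mconj]

theorem mconj_smul {m n : ℕ} (c : ℂ) (u : Matrix (Fin m) (Fin n) ℂ) :
    mconj (c • u) = starRingEnd ℂ c • mconj u := by
  ext
  simp [mconj]

/-- `ψ_A(u) = A ū Ā` satisfies `ψ_A(a ψ_A(b) c) = ψ_A(a) b ψ_A(c)`, and the bracket
`[a,b,c] = i(a A b̄ Ā c − c A b̄ Ā a)` satisfies anti-commutativity and the
fundamental identity. -/
theorem stmt_7 (n : ℕ) (hn : 0 < n) (A : Matrix (Fin n) (Fin n) ℂ) :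
    ∀ ψ : Matrix (Fin n) (Fin n) ℂ → Matrix (Fin n) (Fin n) ℂ,
      (∀ u, ψ u = A * mconj u * mconj A) →
      ((∀ a b c : Matrix (Fin n) (Fin n) ℂ, ψ (a * ψ b * c) = ψ a * b * ψ c) ∧
       (∀ br : Matrix (Fin n) (Fin n) ℂ → Matrix (Fin n) (Fin n) ℂ →
            Matrix (Fin n) (Fin n) ℂ → Matrix (Fin n) (Fin n) ℂ,
          (∀ a b c, br a b c =
            Complex.I • (a * (A * mconj b * mconj A) * c - c * (A * mconj b * mconj A) * a)) →
          ((∀ a b c : Matrix (Fin n) (Fin n) ℂ, br a b c = - br c b a) ∧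
           (∀ a b x y z : Matrix (Fin n) (Fin n) ℂ,
              br a b (br x y z) =
                br (br a b x) y z - br x (br b a y) z + br x y (br a b z))))) := by
  intro ψ hψ
  have hψψ : ∀ a b c, ψ (a * ψ b * c) = ψ a * b * ψ c := by
    intro a b c
    simp only [hψ, mconj_mul, mconj_mconj, Matrix.mul_assoc]
  refine ⟨hψψ, fun br hbr ↦ ?_⟩
  have hbrψ : ∀ a b c, br a b c = Complex.I • (a * ψ b * c - c * ψ b * a) := by
    intro a b c
    rw [hbr, hψ]
  have hψbr : ∀ a b c, ψ (br a b c) = -(Complex.I • (ψ a * b * ψ c - ψ c * b * ψ a)) := by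
    intro a b c
    rw [hbrψ, ← hψψ, ← hψψ]
    simp only [hψ, mconj_smul, mconj_sub, Complex.conj_I, Matrix.mul_sub, Matrix.sub_mul,
      Matrix.mul_smul, Matrix.smul_mul, neg_smul, smul_sub, Matrix.mul_neg, Matrix.neg_mul]
    abel
  refine ⟨fun a b c ↦ ?_, fun a b x y z ↦ ?_⟩
  · rw [hbrψ, hbrψ, ← smul_neg, neg_sub]
  · rw [hbrψ a b (br x y z), hbrψ (br a b x) y z, hbrψ x (br b a y) z, hbrψ x y (br a b z), hψbr,
      hbrψ x y z, hbrψ a b x, hbrψ a b z]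
    simp only [Matrix.mul_sub, Matrix.sub_mul, Matrix.mul_smul, Matrix.smul_mul, smul_sub,
      Matrix.mul_neg, Matrix.neg_mul, smul_neg, Matrix.mul_assoc]
    abel
end

section
/- Let A be a physical N=6 3-algebra, i.e., a complex vector space with a 3-bracket [·,·,·] that is ℂ-linear in the first and third arguments, conjugate-linear in the second, and satisfies anti-commutativity [a,b,c] = −[c,b,a] and the fundamental identity [a,b,[x,y,z]] = [[a,b,x],y,z] − [x,[b,a,y],z] + [x,y,[a,b,z]]. Call an element z ∈ A central if [a,z,c] = 0 for all a,c ∈ A. If z is central, then for all a,b ∈ A the elements [z,a,b] and [a,b,z] are again central; consequently the center of A is an ideal of the 3-algebra A. -/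
/-- In a physical `N=6` 3-algebra, if `z` is central then `[z,a,b]` and `[a,b,z]`
are central for all `a, b`; consequently the center is an ideal. -/
theorem stmt_16 {A : Type*} [AddCommGroup A] [Module ℂ A]
    (br : A → A → A → A)
    (add1 : ∀ a a' b c, br (a + a') b c = br a b c + br a' b c)
    (add2 : ∀ a b b' c, br a (b + b') c = br a b c + br a b' c)
    (add3 : ∀ a b c c', br a b (c + c') = br a b c + br a b c')
    (sm1 : ∀ (l : ℂ) (a b c : A), br (l • a) b c = l • br a b c)
    (sm2 : ∀ (l : ℂ) (a b c : A), br a (l • b) c = (starRingEnd ℂ) l • br a b c)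
    (sm3 : ∀ (l : ℂ) (a b c : A), br a b (l • c) = l • br a b c)
    (anti : ∀ a b c, br a b c = - br c b a)
    (fund : ∀ a b x y z,
      br a b (br x y z) = br (br a b x) y z - br x (br b a y) z + br x y (br a b z))
    (z : A) (hz : ∀ a c, br a z c = 0) :
    ∀ a b : A,
      (∀ x c, br x (br z a b) c = 0) ∧ (∀ x c, br x (br a b z) c = 0) := by
  have zero3 (a b : A) : br a b 0 = 0 := by simpa using sm3 0 a b 0
  have neg2 (a b c : A) : br a (-b) c = -br a b c := by simpa using sm2 (-1) a b c
  have key (a b x c : A) : br x (br a b z) c = 0 := by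
    have h := fund b a x z c
    rw [hz, hz, hz, zero3] at h
    simpa using h
  intro a b
  refine ⟨fun x c => ?_, key a b⟩
  rw [anti z a b, neg2, key, neg_zero]
end
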